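/- Let r > 0 and let S be a finite set of at least 128 points contained in the l₁-ball of radius r centered at the origin in ℝ³, i.e. S ⊆ {x ∈ ℝ³ : ‖x‖₁ ≤ r}. Then there exists a subset T ⊆ S with |T| = 7 and a wake-up tree for T rooted at the origin, with edge lengths measured by the l₁-norm on ℝ³, whose makespan is at most 3r. -/

import Mathlib

/-- `IsWakeUpTree d p₀ S parent t` : `parent` encodes a rooted spanning tree on the node
node set `{p₀} ∪ S` (each non-root node has a parent among the nodes and reaches the root
by iterating `parent`), the root `p₀` has exactly one child (when there is a non-root
node), every non-root node has at most two children, and `t v` is the sum of the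
`d`-distances along the tree path from `p₀` to `v` (so the makespan of the tree is the
maximum of `t` over the nodes). -/
def IsWakeUpTree {X : Type*} (d : X → X → ℝ) (p₀ : X) (S : Finset X)
    (parent : X → X) (t : X → ℝ) : Prop :=
  t p₀ = 0 ∧
  (∀ p ∈ S, p ≠ p₀ →
      (parent p = p₀ ∨ parent p ∈ S) ∧
      t p = t (parent p) + d (parent p) p ∧
      ∃ n : ℕ, parent^[n] p = p₀) ∧
  -- the root has at most one child
  (∀ x ∈ S, x ≠ p₀ → parent x = p₀ →
      ∀ y ∈ S, y ≠ p₀ → parent y = p₀ → x = y) ∧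
  -- the root has a child as soon as there is a non-root node
  ((∃ p ∈ S, p ≠ p₀) → ∃ c ∈ S, c ≠ p₀ ∧ parent c = p₀) ∧
  -- every non-root node has at most two children
  (∀ q ∈ S, q ≠ p₀ → ∀ x ∈ S, ∀ y ∈ S, ∀ z ∈ S,
      x ≠ p₀ → y ≠ p₀ → z ≠ p₀ →
      parent x = q → parent y = q → parent z = q →
      x = y ∨ x = z ∨ y = z)

/-- Seven distinct points other than the root, at pairwise distance at most `r` and such that
some point is at distance at most `r` from the root, have a wake-up tree of makespan at most
`3 r`: the complete binary tree of depth two hanging from the root. -/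
theorem exists_isWakeUpTree_of_fin_seven {X : Type*} (d : X → X → ℝ) (p₀ : X) (r : ℝ)
    (g : Fin 7 → X) (hg : Function.Injective g) (hg₀ : ∀ k, g k ≠ p₀) (hr : 0 ≤ r)
    (hroot : d p₀ (g 0) ≤ r) (hd : ∀ i j, d (g i) (g j) ≤ r)
    (T : Finset X) (hT : ∀ p, p ∈ T ↔ ∃ k, g k = p) :
    ∃ (parent : X → X) (t : X → ℝ), IsWakeUpTree d p₀ T parent t ∧ ∀ p ∈ T, t p ≤ 3 * r := by
  let parentOf : Fin 7 → X := ![p₀, g 0, g 0, g 1, g 1, g 2, g 2]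
  let time : Fin 7 → ℝ :=
    ![d p₀ (g 0),
      d p₀ (g 0) + d (g 0) (g 1),
      d p₀ (g 0) + d (g 0) (g 2),
      d p₀ (g 0) + d (g 0) (g 1) + d (g 1) (g 3),
      d p₀ (g 0) + d (g 0) (g 1) + d (g 1) (g 4),
      d p₀ (g 0) + d (g 0) (g 2) + d (g 2) (g 5),
      d p₀ (g 0) + d (g 0) (g 2) + d (g 2) (g 6)]
  let parent : X → X := Function.extend g parentOf fun _ => p₀
  let t : X → ℝ := Function.extend g time fun _ => 0
  have hparent : ∀ k, parent (g k) = parentOf k := hg.extend_apply _ _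
  have ht : ∀ k, t (g k) = time k := hg.extend_apply _ _
  have ht₀ : t p₀ = 0 := Function.extend_apply' _ _ _ fun ⟨k, hk⟩ => hg₀ k hk
  have hp0 : parent (g 0) = p₀ := hparent 0
  have hp1 : parent (g 1) = g 0 := hparent 1
  have hp2 : parent (g 2) = g 0 := hparent 2
  have hp3 : parent (g 3) = g 1 := hparent 3
  have hp4 : parent (g 4) = g 1 := hparent 4
  have hp5 : parent (g 5) = g 2 := hparent 5
  have hp6 : parent (g 6) = g 2 := hparent 6
  have hparent_root : ∀ k, parent (g k) = p₀ → k = 0 := by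
    intro k hk
    fin_cases k <;> simp_all
  have hparent_node : ∀ k l, parent (g k) = g l →
      (k : ℕ) = 2 * l + 1 ∨ (k : ℕ) = 2 * l + 2 := by
    intro k l hk
    rw [hparent] at hk
    fin_cases k
    · exact absurd hk.symm (hg₀ l)
    all_goals
      have hl := hg hk
      subst hl
      simp
  refine ⟨parent, t, ⟨ht₀, ?_, ?_, ?_, ?_⟩, ?_⟩
  · intro p hp _
    obtain ⟨k, rfl⟩ := (hT p).1 hp
    have hmem : ∀ k, g k ∈ T := fun k => (hT _).2 ⟨k, rfl⟩
    refine ⟨?_, ?_, ?_⟩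
    · fin_cases k
      · exact Or.inl hp0
      all_goals exact Or.inr ((hparent _).symm ▸ hmem _)
    · fin_cases k
      · change t (g 0) = t (parent (g 0)) + d (parent (g 0)) (g 0)
        rw [hp0, ht₀, ht, zero_add]
        rfl
      all_goals
        rw [hparent]
        change t (g _) = t (g _) + d (g _) (g _)
        rw [ht, ht]
        rfl
    · fin_cases k
      · exact ⟨1, hp0⟩
      · exact ⟨2, by simp [hp1, hp0]⟩
      · exact ⟨2, by simp [hp2, hp0]⟩
      · exact ⟨3, by simp [hp3, hp1, hp0]⟩
      · exact ⟨3, by simp [hp4, hp1, hp0]⟩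
      · exact ⟨3, by simp [hp5, hp2, hp0]⟩
      · exact ⟨3, by simp [hp6, hp2, hp0]⟩
  · intro x hx _ hxp y hy _ hyp
    obtain ⟨i, rfl⟩ := (hT x).1 hx
    obtain ⟨j, rfl⟩ := (hT y).1 hy
    rw [hparent_root i hxp, hparent_root j hyp]
  · exact fun _ => ⟨g 0, (hT _).2 ⟨0, rfl⟩, hg₀ 0, hp0⟩
  · intro q hq _ x hx y hy z hz _ _ _ hxq hyq hzq
    obtain ⟨l, rfl⟩ := (hT q).1 hq
    obtain ⟨i, rfl⟩ := (hT x).1 hx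
    obtain ⟨j, rfl⟩ := (hT y).1 hy
    obtain ⟨k, rfl⟩ := (hT z).1 hz
    have hi := hparent_node i l hxq
    have hj := hparent_node j l hyq
    have hk := hparent_node k l hzq
    simp only [hg.eq_iff, Fin.ext_iff]
    omega
  · intro p hp
    obtain ⟨k, rfl⟩ := (hT p).1 hp
    rw [ht]
    have h1 := hd 0 1
    have h2 := hd 0 2
    have h3 := hd 1 3
    have h4 := hd 1 4
    have h5 := hd 2 5
    have h6 := hd 2 6
    fin_cases k <;> simp [time] <;> linarith

/-- Pieces of `l₁`-diameter at most `r` covering the `l₁`-ball of radius `r` in `ℝ³`: the six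
balls of radius `r / 2` tangent to it from inside at its vertices, and in each orthant the
tetrahedron spanned by the origin and the midpoints of the edges of the opposite facet. -/
def l1BallPiece (r : ℝ) : (Fin 3 × Bool) ⊕ (Fin 3 → Bool) → Set (Fin 3 → ℝ)
  | .inl (i, b) => {p | ∑ j, |p j - (Pi.single i (bif b then r / 2 else -(r / 2)) : Fin 3 → ℝ) j|
      ≤ r / 2}
  | .inr s => {p | ∑ j, |p j| ≤ r ∧ (∀ j, |p j| = bif s j then p j else -p j) ∧
      ∀ i, 2 * |p i| ≤ ∑ j, |p j|}

theorem exists_mem_l1BallPiece (r : ℝ) (p : Fin 3 → ℝ) (hp : ∑ i, |p i| ≤ r) :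
    ∃ c, p ∈ l1BallPiece r c := by
  by_cases h : ∀ i, 2 * |p i| ≤ ∑ j, |p j|
  · refine ⟨.inr fun j => decide (0 ≤ p j), hp, fun j => ?_, h⟩
    by_cases hj : 0 ≤ p j
    · simp [hj]
    · simp [hj, abs_of_neg (not_le.1 hj)]
  · push Not at h
    obtain ⟨i, hi⟩ := h
    refine ⟨.inl (i, decide (0 ≤ p i)), ?_⟩
    have key : ∀ x : ℝ, |x - bif decide (0 ≤ x) then r / 2 else -(r / 2)| = |(|x| - r / 2)| := by
      intro x
      by_cases hx : 0 ≤ x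
      · simp [hx, abs_of_nonneg hx]
      · rw [abs_of_neg (not_le.1 hx), ← abs_neg]
        simp only [hx, decide_false, cond_false]
        congr 1
        ring
    change ∑ j, |p j - (Pi.single i _ : Fin 3 → ℝ) j| ≤ r / 2
    have hkey := key (p i)
    rw [Fin.sum_univ_three] at hp hi ⊢
    have habs : |(|p i| - r / 2)| ≤ r / 2 - (|p 0| + |p 1| + |p 2| - |p i|) := by
      rw [abs_le]
      constructor <;> linarith
    fin_cases i <;> simp at hkey habs ⊢ <;> linarith

theorem l1_dist_le_of_mem_l1BallPiece (r : ℝ) (c) (p q : Fin 3 → ℝ)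
    (hp : p ∈ l1BallPiece r c) (hq : q ∈ l1BallPiece r c) : ∑ i, |p i - q i| ≤ r := by
  match c with
  | .inl (i, b) =>
    change ∑ j, |p j - (Pi.single i _ : Fin 3 → ℝ) j| ≤ r / 2 at hp
    change ∑ j, |q j - (Pi.single i _ : Fin 3 → ℝ) j| ≤ r / 2 at hq
    calc ∑ j, |p j - q j|
        ≤ ∑ j, (|p j - (Pi.single i (bif b then r / 2 else -(r / 2)) : Fin 3 → ℝ) j|
          + |q j - (Pi.single i (bif b then r / 2 else -(r / 2)) : Fin 3 → ℝ) j|) := by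
          refine Finset.sum_le_sum fun j _ => ?_
          rw [abs_sub_comm (q j)]
          exact abs_sub_le _ _ _
      _ ≤ r := by
          rw [Finset.sum_add_distrib]
          linarith
  | .inr s =>
    obtain ⟨hpr, hps, hpt⟩ := hp
    obtain ⟨hqr, hqs, hqt⟩ := hq
    have key : ∀ j, |p j - q j| = |(|p j| - |q j|)| := by
      intro j
      rw [hps, hqs]
      cases s j
      · simp only [cond_false]
        rw [neg_sub_neg, abs_sub_comm]
      · rfl
    simp only [key]
    simp only [Fin.sum_univ_three] at *
    have hp0 := hpt 0
    have hp1 := hpt 1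
    have hp2 := hpt 2
    have hq0 := hqt 0
    have hq1 := hqt 1
    have hq2 := hqt 2
    have := abs_nonneg (p 0)
    have := abs_nonneg (p 1)
    have := abs_nonneg (p 2)
    have := abs_nonneg (q 0)
    have := abs_nonneg (q 1)
    have := abs_nonneg (q 2)
    rcases abs_cases (|p 0| - |q 0|) with ⟨h0, _⟩ | ⟨h0, _⟩ <;>
    rcases abs_cases (|p 1| - |q 1|) with ⟨h1, _⟩ | ⟨h1, _⟩ <;>
    rcases abs_cases (|p 2| - |q 2|) with ⟨h2, _⟩ | ⟨h2, _⟩ <;>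
    rw [h0, h1, h2] <;> linarith

/-- among at least `128` points in the `l₁`-ball of radius `r` in `ℝ³`, some
seven of them admit a wake-up tree rooted at the origin, with `l₁`-norm edge lengths, of
makespan at most `3 r`. -/
theorem freezeTag_l1Ball_R3_sevenRobots (r : ℝ) (hr : 0 < r) (S : Finset (Fin 3 → ℝ))
    (hcard : 128 ≤ S.card) (hS : ∀ p ∈ S, ∑ i, |p i| ≤ r) :
    ∃ T : Finset (Fin 3 → ℝ), T ⊆ S ∧ T.card = 7 ∧
      ∃ (parent : (Fin 3 → ℝ) → (Fin 3 → ℝ)) (t : (Fin 3 → ℝ) → ℝ),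
        IsWakeUpTree (fun u v => ∑ i, |u i - v i|) (0 : Fin 3 → ℝ) T parent t ∧
        ∀ p ∈ T, t p ≤ 3 * r := by
  classical
  choose! c hc using fun p hp => exists_mem_l1BallPiece r p (hS p hp)
  have hcard' : 6 * (Finset.univ : Finset ((Fin 3 × Bool) ⊕ (Fin 3 → Bool))).card
      < (S.erase 0).card := by
    have := Finset.pred_card_le_card_erase (s := S) (a := 0)
    simp only [Finset.card_univ, Fintype.card_sum, Fintype.card_prod, Fintype.card_fin,
      Fintype.card_bool, Fintype.card_fun]
    omega
  obtain ⟨a, _, ha⟩ := Finset.exists_lt_card_fiber_of_mul_lt_card_of_maps_to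
    (f := c) (fun _ _ => Finset.mem_univ _) (by rwa [mul_comm] at hcard')
  obtain ⟨T, hT, hT7⟩ := Finset.exists_subset_card_eq (Nat.succ_le_of_lt ha)
  have hT' : ∀ p ∈ T, p ≠ 0 ∧ p ∈ S ∧ p ∈ l1BallPiece r a := by
    intro p hp
    have h := hT hp
    simp only [Finset.mem_filter, Finset.mem_erase] at h
    exact ⟨h.1.1, h.1.2, h.2 ▸ hc p h.1.2⟩
  let e : Fin 7 ≃ T := (Finset.equivFinOfCardEq hT7).symm
  refine ⟨T, fun p hp => (hT' p hp).2.1, hT7, ?_⟩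
  refine exists_isWakeUpTree_of_fin_seven _ _ r (fun k => (e k : Fin 3 → ℝ))
    (Subtype.val_injective.comp e.injective) (fun k => (hT' _ (e k).2).1) hr.le ?_
    (fun i j => l1_dist_le_of_mem_l1BallPiece r a _ _ (hT' _ (e i).2).2.2 (hT' _ (e j).2).2.2)
    T fun p => ⟨fun hp => ⟨e.symm ⟨p, hp⟩, by simp⟩, ?_⟩
  · simpa using hS _ (hT' _ (e 0).2).2.1
  · rintro ⟨k, rfl⟩
    exact (e k).2
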